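/- Let e ≥ 1 be an integer and let R = ℤ[u_0,…,u_e, v_0,…,v_e] be the polynomial ring over ℤ in these 2e+2 indeterminates. Let Q = Σ_{i=0}^{e} u_i·T^i and S = Σ_{i=0}^{e} v_i·T^i in R[T] be generic polynomials of degree e, and set G = T·Q − S, a polynomial of degree e+1 with leading coefficient u_e. Then there exists D ∈ R such that Res(G, G') = u_e·D (where G' is the derivative of G and Res(G,G') is the determinant of the (2e+1)×(2e+1) Sylvester matrix of G and G'), and D is an irreducible element of R. -/

import Mathlib

/-- The Sylvester matrix of two univariate polynomials `P` and `Q` over a commutative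
ring, where `P` is regarded as a polynomial of (formal) degree `m` and `Q` as a
polynomial of (formal) degree `n`.  It is the `(m+n) × (m+n)` matrix whose first `n`
rows carry the (shifted) coefficients of `P` and whose last `m` rows carry the
(shifted) coefficients of `Q`. -/
def sylvesterMatrix {R : Type*} [CommRing R] (m n : ℕ) (P Q : Polynomial R) :
    Matrix (Fin (m + n)) (Fin (m + n)) R :=
  Matrix.of fun i j =>
    if (i : ℕ) < n then
      if (i : ℕ) ≤ (j : ℕ) then P.coeff ((j : ℕ) - (i : ℕ)) else 0
    else
      if (i : ℕ) - n ≤ (j : ℕ) then Q.coeff ((j : ℕ) - ((i : ℕ) - n)) else 0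

/-- The resultant of `P`, of formal degree `m`, and `Q`, of formal degree `n`:
the determinant of their `(m+n) × (m+n)` Sylvester matrix. -/
def res {R : Type*} [CommRing R] (m n : ℕ) (P Q : Polynomial R) : R :=
  (sylvesterMatrix m n P Q).det

open Finset

section Resultant

variable {R : Type*} [CommRing R]

theorem res_eq_resultant (m n : ℕ) (P Q : Polynomial R) (hP : P.natDegree ≤ m)
    (hQ : Q.natDegree ≤ n) : res m n P Q = Polynomial.resultant Q P n m := by
  rw [res, Polynomial.resultant, ← Matrix.det_transpose,
    ← Matrix.det_reindex_self (finCongr (add_comm m n))]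
  congr 1
  ext i j
  induction j using Fin.addCases with
  | left j =>
    simp only [sylvesterMatrix, Polynomial.sylvester, Matrix.reindex_apply, finCongr_symm,
      Matrix.submatrix_apply, Matrix.transpose_apply, Matrix.of_apply, finCongr_apply,
      Fin.val_cast, Fin.val_castAdd, Fin.addCases_left, Set.mem_Icc, j.2, if_true]
    split_ifs
    · rfl
    · exact Polynomial.coeff_eq_zero_of_natDegree_lt (by omega)
    · omega
    · rfl
  | right j =>
    simp only [sylvesterMatrix, Polynomial.sylvester, Matrix.reindex_apply, finCongr_symm,
      Matrix.submatrix_apply, Matrix.transpose_apply, Matrix.of_apply, finCongr_apply,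
      Fin.val_cast, Fin.val_natAdd, Fin.addCases_right, Set.mem_Icc, add_tsub_cancel_left,
      not_lt.mpr (Nat.le_add_right n j), if_false]
    split_ifs
    · rfl
    · exact Polynomial.coeff_eq_zero_of_natDegree_lt (by omega)
    · omega
    · rfl

/-- The product of the linear polynomials `y i * T - x i`. -/
noncomputable def linearFormProd {ι : Type*} [Fintype ι] (x y : ι → R) : Polynomial R :=
  ∏ i, (Polynomial.C (y i) * Polynomial.X - Polynomial.C (x i))

theorem map_linearFormProd {S ι : Type*} [CommRing S] [Fintype ι] (φ : R →+* S) (x y : ι → R) :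
    (linearFormProd x y).map φ = linearFormProd (φ ∘ x) (φ ∘ y) := by
  simp [linearFormProd, Polynomial.map_prod]

theorem linearFormProd_comp_perm {ι : Type*} [Fintype ι] (x y : ι → R) (σ : Equiv.Perm ι) :
    linearFormProd (x ∘ σ) (y ∘ σ) = linearFormProd x y :=
  Equiv.prod_comp σ fun i ↦ Polynomial.C (y i) * Polynomial.X - Polynomial.C (x i)

theorem natDegree_C_mul_X_sub_C {a : R} (ha : a ≠ 0) (b : R) :
    (Polynomial.C a * Polynomial.X - Polynomial.C b).natDegree = 1 := by
  simpa [sub_eq_add_neg] using Polynomial.natDegree_linear (b := -b) ha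

theorem leadingCoeff_C_mul_X_sub_C {a : R} (ha : a ≠ 0) (b : R) :
    (Polynomial.C a * Polynomial.X - Polynomial.C b).leadingCoeff = a := by
  simpa [sub_eq_add_neg] using Polynomial.leadingCoeff_linear (b := -b) ha

theorem natDegree_prod_C_mul_X_sub_C [IsDomain R] {ι : Type*} (s : Finset ι) (x y : ι → R)
    (hy : ∀ i, y i ≠ 0) :
    (∏ i ∈ s, (Polynomial.C (y i) * Polynomial.X - Polynomial.C (x i))).natDegree = #s := by
  rw [Polynomial.natDegree_prod]
  · simp [natDegree_C_mul_X_sub_C (hy _)]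
  · intro i _ h
    simpa [h] using natDegree_C_mul_X_sub_C (hy i) (x i)

theorem resultant_C_mul_X_sub_C (a b c d : R) :
    Polynomial.resultant (Polynomial.C a * Polynomial.X - Polynomial.C b)
      (Polynomial.C c * Polynomial.X - Polynomial.C d) 1 1 = b * c - d * a := by
  have h0 : ((Polynomial.C a * Polynomial.X - Polynomial.C b).sylvester
      (Polynomial.C c * Polynomial.X - Polynomial.C d) 1 1) = !![-d, -b; c, a] := by
    ext i j
    fin_cases i <;> fin_cases j <;> simp [Polynomial.sylvester, Fin.addCases]
  rw [Polynomial.resultant, h0, Matrix.det_fin_two_of]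
  ring

theorem resultant_linearFormProd_derivative [IsDomain R] (e : ℕ) (he : 1 ≤ e)
    (x y : Fin (e + 1) → R) (hy : ∀ i, y i ≠ 0) :
    Polynomial.resultant (linearFormProd x y) (Polynomial.derivative (linearFormProd x y))
      (e + 1) e = (∏ i, y i) * ∏ i, ∏ j ∈ univ.erase i, (x i * y j - x j * y i) := by
  set L : Fin (e + 1) → Polynomial R :=
    fun i ↦ Polynomial.C (y i) * Polynomial.X - Polynomial.C (x i) with hL
  have hdeg : (linearFormProd x y).natDegree = e + 1 :=
    (natDegree_prod_C_mul_X_sub_C univ x y hy).trans (by simp)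
  have hlead (s : Finset (Fin (e + 1))) : ∏ i ∈ s, (L i).leadingCoeff ≠ 0 :=
    prod_ne_zero_iff.mpr fun i _ ↦ by
      simpa only [hL, leadingCoeff_C_mul_X_sub_C (hy i)] using hy i
  have hder : (Polynomial.derivative (linearFormProd x y)).natDegree ≤ e := by
    simpa [hdeg] using Polynomial.natDegree_derivative_le (linearFormProd x y)
  have key := Polynomial.resultant_prod_left univ L
    (Polynomial.derivative (linearFormProd x y)) e (hlead _) hder
  rw [show ∏ i, L i = linearFormProd x y from rfl, hdeg] at key
  rw [key, ← prod_mul_distrib]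
  refine prod_congr rfl fun i _ ↦ ?_
  have hLi : (L i).natDegree = 1 := natDegree_C_mul_X_sub_C (hy i) _
  set H := ∏ j ∈ univ.erase i, L j with hH
  have hHdeg : H.natDegree = e := by
    simpa using natDegree_prod_C_mul_X_sub_C (univ.erase i) x y hy
  have hF : linearFormProd x y = L i * H := (mul_prod_erase univ L (mem_univ i)).symm
  have hd : Polynomial.derivative (linearFormProd x y) =
      Polynomial.C (y i) * H + L i * Polynomial.derivative H := by
    rw [hF, Polynomial.derivative_mul]
    simp [hL]
  have hHd := Polynomial.natDegree_derivative_le H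
  rw [hLi, hd, Polynomial.resultant_add_mul_right _ _ _ _ _ (by omega) hLi.le,
    Polynomial.resultant_C_mul_right, pow_one]
  congr 1
  have := Polynomial.resultant_prod_right (univ.erase i) (L i) L 1 hLi.le (hlead _)
  rw [← hH, hHdeg] at this
  rw [this]
  refine prod_congr rfl fun j _ ↦ ?_
  rw [show (L j).natDegree = 1 from natDegree_C_mul_X_sub_C (hy j) _]
  exact resultant_C_mul_X_sub_C _ _ _ _

end Resultant

section Bracket

variable {ι κ : Type*}

/-- The bracket `x i * y j - x j * y i` of two generic points of the projective line. -/
noncomputable def bracket (κ : Type*) (i j : ι) : MvPolynomial ((ι ⊕ ι) ⊕ κ) ℤ :=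
  MvPolynomial.X (.inl (.inl i)) * MvPolynomial.X (.inl (.inr j)) -
    MvPolynomial.X (.inl (.inl j)) * MvPolynomial.X (.inl (.inr i))

/-- The action of a permutation of the generic points. -/
noncomputable def permPoints (κ : Type*) (σ : Equiv.Perm ι) :
    MvPolynomial ((ι ⊕ ι) ⊕ κ) ℤ →ₐ[ℤ] MvPolynomial ((ι ⊕ ι) ⊕ κ) ℤ :=
  MvPolynomial.rename (Sum.map (Sum.map σ σ) id)

theorem permPoints_bracket (σ : Equiv.Perm ι) (i j : ι) :
    permPoints κ σ (bracket κ i j) = bracket κ (σ i) (σ j) := by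
  simp [permPoints, bracket]

theorem bracket_antisymm (i j : ι) : bracket κ i j = -bracket κ j i := by
  simp [bracket]

theorem prime_bracket {i j : ι} (hij : i ≠ j) : Prime (bracket κ i j) := by
  classical
  rw [← UniqueFactorizationMonoid.irreducible_iff_prime]
  have hX (a b : (ι ⊕ ι) ⊕ κ) (h : a ∈ (MvPolynomial.X b : MvPolynomial _ ℤ).vars) : a = b := by
    simpa [MvPolynomial.vars_X] using h
  have h := MvPolynomial.irreducible_mul_X_add (R := ℤ)
    (MvPolynomial.X (.inl (.inr j)))
    (-(MvPolynomial.X (.inl (.inl j)) * MvPolynomial.X (.inl (.inr i))))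
    (.inl (.inl i) : (ι ⊕ ι) ⊕ κ) (MvPolynomial.X_ne_zero _)
    (fun h ↦ by simpa using hX _ _ h)
    (fun h ↦ by
      rw [MvPolynomial.vars_neg] at h
      rcases mem_union.mp (MvPolynomial.vars_mul _ _ h) with h | h
      · exact hij (by simpa using hX _ _ h)
      · simpa using hX _ _ h)
    (by
      rw [IsRelPrime.neg_right_iff, MvPolynomial.X_prime.irreducible.isRelPrime_iff_not_dvd,
        MvPolynomial.X_prime.dvd_mul, MvPolynomial.X_dvd_X, MvPolynomial.X_dvd_X]
      simpa using hij.symm)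
  rw [bracket, sub_eq_add_neg, mul_comm (MvPolynomial.X (Sum.inl (Sum.inl i)))]
  exact h

theorem eq_or_eq_of_bracket_dvd_bracket {i j k l : ι} (hkl : k ≠ l)
    (h : bracket κ i j ∣ bracket κ k l) : (k = i ∧ l = j) ∨ (k = j ∧ l = i) := by
  classical
  let t : ι → MvPolynomial ι ℤ := fun m ↦ if m = i then MvPolynomial.X j else MvPolynomial.X m
  have ht := map_dvd (MvPolynomial.aeval (R := ℤ)
    (Sum.elim (Sum.elim t (fun _ ↦ (1 : MvPolynomial ι ℤ))) (fun _ : κ ↦ 0))) h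
  have hij : t i - t j = 0 := by
    by_cases hji : j = i <;> simp [t, hji]
  have hkl' : t k = t l := by
    simpa [bracket, hij, sub_eq_zero] using ht
  by_cases hk : k = i <;> by_cases hl : l = i <;>
    simp_all [t, MvPolynomial.X_injective.eq_iff]

theorem exists_perm_apply_eq_apply_eq {i j k l : ι} (hij : i ≠ j) (hkl : k ≠ l) :
    ∃ σ : Equiv.Perm ι, σ i = k ∧ σ j = l := by
  classical
  refine ⟨(Equiv.swap i k).trans (Equiv.swap (Equiv.swap i k j) l), ?_, by simp⟩
  rw [Equiv.trans_apply, Equiv.swap_apply_left]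
  refine Equiv.swap_apply_of_ne_of_ne (fun h ↦ hij ?_) hkl
  rw [← Equiv.swap_apply_left i k] at h
  exact (Equiv.swap i k).injective (by simpa using h)

variable {n : ℕ}

/-- The product of the brackets of all pairs of distinct points. -/
noncomputable def bracketVandermonde (n : ℕ) (κ : Type*) :
    MvPolynomial ((Fin n ⊕ Fin n) ⊕ κ) ℤ :=
  ∏ j, ∏ i ∈ Iio j, bracket κ i j

theorem prod_prod_erase_bracket :
    ∏ i : Fin n, ∏ j ∈ univ.erase i, bracket κ i j =
      (∏ j : Fin n, ∏ _i ∈ Iio j, (-1)) * bracketVandermonde n κ ^ 2 := by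
  have h1 (i : Fin n) : univ.erase i = Iio i ∪ Ioi i := by
    ext j
    simp [lt_or_lt_iff_ne]
  have h2 (i : Fin n) : ∏ j ∈ univ.erase i, bracket κ i j =
      (∏ j ∈ Iio i, bracket κ i j) * ∏ j ∈ Ioi i, bracket κ i j := by
    rw [h1, prod_union]
    exact disjoint_left.mpr fun j hj hj' ↦ lt_asymm (mem_Iio.mp hj) (mem_Ioi.mp hj')
  have h3 : ∏ i : Fin n, ∏ j ∈ Ioi i, bracket κ i j = bracketVandermonde n κ :=
    prod_comm' (by simp)
  have h4 (i : Fin n) : ∏ j ∈ Iio i, bracket κ i j =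
      (∏ _j ∈ Iio i, (-1)) * ∏ j ∈ Iio i, bracket κ j i := by
    rw [← prod_mul_distrib]
    exact prod_congr rfl fun j _ ↦ by rw [bracket_antisymm, neg_one_mul]
  simp_rw [h2, prod_mul_distrib, h3, h4, prod_mul_distrib]
  rw [sq, ← mul_assoc, bracketVandermonde]

theorem bracketVandermonde_dvd {f : MvPolynomial ((Fin n ⊕ Fin n) ⊕ κ) ℤ}
    (h : ∀ i j, i ≠ j → bracket κ i j ∣ f) : bracketVandermonde n κ ∣ f := by
  rw [bracketVandermonde, prod_sigma']
  refine prod_dvd_of_isRelPrime (fun a ha b hb hab ↦ ?_) fun a ha ↦ h _ _ ?_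
  · simp only [coe_sigma, Set.mem_sigma_iff, mem_coe, mem_univ, mem_Iio, true_and] at ha hb
    refine ((prime_bracket ha.ne).irreducible.isRelPrime_iff_not_dvd).mpr fun hd ↦ ?_
    rcases eq_or_eq_of_bracket_dvd_bracket hb.ne hd with ⟨h1, h2⟩ | ⟨h1, h2⟩
    · exact hab (Sigma.ext h2.symm (heq_of_eq h1.symm))
    · rw [h1, h2] at hb
      exact lt_asymm ha hb
  · simp only [mem_sigma, mem_univ, mem_Iio, true_and] at ha
    exact ha.ne

theorem bracketVandermonde_ne_zero : bracketVandermonde n κ ≠ 0 :=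
  prod_ne_zero_iff.mpr fun _ _ ↦ prod_ne_zero_iff.mpr fun _ hi ↦
    (prime_bracket (mem_Iio.mp hi).ne).ne_zero

theorem permPoints_bracketVandermonde (σ : Equiv.Perm (Fin n)) :
    permPoints κ σ (bracketVandermonde n κ) =
      (σ.sign : ℤ) * bracketVandermonde n κ := by
  simp_rw [bracketVandermonde, map_prod, permPoints_bracket]
  exact σ.prod_Iio_comp_eq_sign_mul_prod bracket_antisymm

/-- A symmetric nonunit dividing a power of the Vandermonde product is divisible by it. -/
theorem bracketVandermonde_dvd_of_symmetric {f : MvPolynomial ((Fin n ⊕ Fin n) ⊕ κ) ℤ}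
    (hf : ∀ σ, permPoints κ σ f = f) (hfu : ¬ IsUnit f) {k : ℕ}
    (hdvd : f ∣ bracketVandermonde n κ ^ k) : bracketVandermonde n κ ∣ f := by
  have hf0 : f ≠ 0 := fun h ↦
    pow_ne_zero k bracketVandermonde_ne_zero (zero_dvd_iff.mp (h ▸ hdvd))
  obtain ⟨q, hq, hqf⟩ := WfDvdMonoid.exists_irreducible_factor hfu hf0
  have hqp := UniqueFactorizationMonoid.irreducible_iff_prime.mp hq
  obtain ⟨j, -, hj⟩ := (hqp.dvd_finsetProd_iff _).mp (hqp.dvd_of_dvd_pow (hqf.trans hdvd))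
  obtain ⟨i, hi, hij⟩ := (hqp.dvd_finsetProd_iff _).mp hj
  have hne : i ≠ j := (mem_Iio.mp hi).ne
  have hbf : bracket κ i j ∣ f :=
    ((hqp.associated_of_dvd (prime_bracket hne) hij).symm.dvd).trans hqf
  refine bracketVandermonde_dvd fun k l hkl ↦ ?_
  obtain ⟨σ, rfl, rfl⟩ := exists_perm_apply_eq_apply_eq hne hkl
  rw [← permPoints_bracket, ← hf σ]
  exact map_dvd _ hbf

theorem isUnit_or_isUnit_of_mul_eq_bracketVandermonde_sq (hn : 2 ≤ n)
    {f g ε : MvPolynomial ((Fin n ⊕ Fin n) ⊕ κ) ℤ}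
    (hf : ∀ σ, permPoints κ σ f = f) (hg : ∀ σ, permPoints κ σ g = g) (hε : IsUnit ε)
    (hfg : f * g = ε * bracketVandermonde n κ ^ 2) : IsUnit f ∨ IsUnit g := by
  by_contra! h
  have hfd : f ∣ bracketVandermonde n κ ^ 2 := hε.dvd_mul_left.mp (hfg ▸ dvd_mul_right f g)
  have hgd : g ∣ bracketVandermonde n κ ^ 2 := hε.dvd_mul_left.mp (hfg ▸ dvd_mul_left g f)
  obtain ⟨a, rfl⟩ := bracketVandermonde_dvd_of_symmetric hf h.1 hfd
  obtain ⟨b, rfl⟩ := bracketVandermonde_dvd_of_symmetric hg h.2 hgd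
  have hV := bracketVandermonde_ne_zero (n := n) (κ := κ)
  have hab : a * b = ε := mul_right_cancel₀ (pow_ne_zero 2 hV) (by rw [← hfg]; ring)
  have ha : IsUnit a := isUnit_of_mul_isUnit_left (hab ▸ hε)
  obtain ⟨r, hr, rfl⟩ := MvPolynomial.isUnit_iff_eq_C_of_isReduced.mp ha
  have hswap : (⟨0, by omega⟩ : Fin n) ≠ ⟨1, by omega⟩ := by simp
  have h1 := hf (Equiv.swap ⟨0, by omega⟩ ⟨1, by omega⟩)
  rw [map_mul, permPoints_bracketVandermonde, Equiv.Perm.sign_swap hswap,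
    MvPolynomial.algHom_C] at h1
  have h2 : bracketVandermonde n κ * MvPolynomial.C r = 0 := by
    rw [← self_eq_neg]
    conv_lhs => rw [← h1]
    simp
  exact mul_ne_zero hV ha.ne_zero h2

end Bracket

section Generic

/-- The polynomial `T * Q - S` where `Q` and `S` have coefficients `u` and `v`. -/
noncomputable def mulXSub {R : Type*} [CommRing R] {e : ℕ} (u v : Fin (e + 1) → R) :
    Polynomial R :=
  Polynomial.X * ∑ i : Fin (e + 1), Polynomial.C (u i) * Polynomial.X ^ (i : ℕ) -
    ∑ i : Fin (e + 1), Polynomial.C (v i) * Polynomial.X ^ (i : ℕ)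

section Coeff

variable {R : Type*} [CommRing R] {e : ℕ} (u v : Fin (e + 1) → R)

theorem coeff_sum_C_mul_X_pow (c : Fin (e + 1) → R) (k : Fin (e + 1)) :
    (∑ i : Fin (e + 1), Polynomial.C (c i) * Polynomial.X ^ (i : ℕ)).coeff k = c k := by
  simp [Polynomial.finsetSum_coeff, Polynomial.coeff_X_pow, Fin.val_inj]

theorem coeff_sum_C_mul_X_pow_of_lt (c : Fin (e + 1) → R) {k : ℕ} (hk : e < k) :
    (∑ i : Fin (e + 1), Polynomial.C (c i) * Polynomial.X ^ (i : ℕ)).coeff k = 0 := by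
  rw [Polynomial.finsetSum_coeff]
  refine sum_eq_zero fun i _ ↦ ?_
  rw [Polynomial.coeff_C_mul_X_pow, if_neg (by omega)]

theorem coeff_zero_mulXSub : (mulXSub u v).coeff 0 = -v 0 := by
  simpa [mulXSub] using coeff_sum_C_mul_X_pow v 0

theorem coeff_succ_mulXSub (i : Fin e) :
    (mulXSub u v).coeff (i + 1) = u i.castSucc - v i.succ := by
  rw [mulXSub, Polynomial.coeff_sub, Polynomial.coeff_X_mul]
  exact congrArg₂ _ (coeff_sum_C_mul_X_pow u i.castSucc) (coeff_sum_C_mul_X_pow v i.succ)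

theorem coeff_last_mulXSub : (mulXSub u v).coeff (e + 1) = u (Fin.last e) := by
  rw [mulXSub, Polynomial.coeff_sub, Polynomial.coeff_X_mul,
    coeff_sum_C_mul_X_pow_of_lt v e.lt_succ_self, sub_zero]
  exact coeff_sum_C_mul_X_pow u (Fin.last e)

theorem natDegree_mulXSub_le : (mulXSub u v).natDegree ≤ e + 1 := by
  refine Polynomial.natDegree_le_iff_coeff_eq_zero.mpr fun k hk ↦ ?_
  obtain ⟨k, rfl⟩ := Nat.exists_eq_succ_of_ne_zero (by omega : k ≠ 0)
  rw [mulXSub, Polynomial.coeff_sub, Nat.succ_eq_add_one, Polynomial.coeff_X_mul,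
    coeff_sum_C_mul_X_pow_of_lt u (by omega), coeff_sum_C_mul_X_pow_of_lt v (by omega), sub_zero]

theorem map_mulXSub {S : Type*} [CommRing S] (φ : R →+* S) :
    (mulXSub u v).map φ = mulXSub (φ ∘ u) (φ ∘ v) := by
  simp [mulXSub, Polynomial.map_sum]

theorem mulXSub_eq {u v} {P : Polynomial R} (hP : P.natDegree ≤ e + 1)
    (h0 : -v 0 = P.coeff 0) (hs : ∀ i : Fin e, u i.castSucc - v i.succ = P.coeff (i + 1))
    (hl : u (Fin.last e) = P.coeff (e + 1)) : mulXSub u v = P := by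
  ext k
  obtain hk | hk := lt_or_ge (e + 1) k
  · rw [Polynomial.coeff_eq_zero_of_natDegree_lt (hP.trans_lt hk),
      Polynomial.coeff_eq_zero_of_natDegree_lt ((natDegree_mulXSub_le u v).trans_lt hk)]
  obtain _ | k := k
  · rw [coeff_zero_mulXSub, h0]
  obtain hk | rfl := (Nat.le_of_succ_le_succ hk).lt_or_eq
  · exact (coeff_succ_mulXSub u v ⟨k, hk⟩).trans (hs ⟨k, hk⟩)
  · rw [coeff_last_mulXSub, hl]

end Coeff

theorem natDegree_linearFormProd_le {R : Type*} [CommRing R] {n : ℕ} (x y : Fin n → R) :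
    (linearFormProd x y).natDegree ≤ n := by
  refine (Polynomial.natDegree_prod_le _ _).trans ?_
  refine (sum_le_card_nsmul _ _ 1 fun i _ ↦ ?_).trans (by simp)
  simpa [sub_eq_add_neg] using Polynomial.natDegree_linear_le (a := y i) (b := -x i)

theorem coeff_linearFormProd {R : Type*} [CommRing R] {n : ℕ} (x y : Fin n → R) :
    (linearFormProd x y).coeff n = ∏ i, y i := by
  have h := Polynomial.coeff_prod_of_natDegree_le univ
    (fun i ↦ Polynomial.C (y i) * Polynomial.X - Polynomial.C (x i)) 1 fun i _ ↦ by
      simpa [sub_eq_add_neg] using Polynomial.natDegree_linear_le (a := y i) (b := -x i)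
  rw [linearFormProd]
  simpa [Polynomial.coeff_C] using h

theorem exists_eq_linearFormProd {K : Type*} [Field K] [IsAlgClosed K] (e : ℕ)
    (P : Polynomial K) (hP : P.natDegree = e + 1) :
    ∃ x y : Fin (e + 1) → K, P = linearFormProd x y := by
  induction e generalizing P with
  | zero =>
    refine ⟨fun _ ↦ -P.coeff 0, fun _ ↦ P.coeff 1, ?_⟩
    simpa [linearFormProd] using Polynomial.eq_X_add_C_of_natDegree_le_one hP.le
  | succ e ih =>
    obtain ⟨r, hr⟩ := IsAlgClosed.exists_root P fun h ↦ by
      simp [Polynomial.natDegree_eq_of_degree_eq_some h] at hP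
    obtain ⟨P', rfl⟩ := Polynomial.dvd_iff_isRoot.mpr hr
    have hP' : P' ≠ 0 := by
      rintro rfl
      simp at hP
    rw [Polynomial.natDegree_mul (Polynomial.X_sub_C_ne_zero r) hP',
      Polynomial.natDegree_X_sub_C] at hP
    obtain ⟨x, y, rfl⟩ := ih P' (by omega)
    exact ⟨Fin.cons r x, Fin.cons 1 y, by simp [linearFormProd, Fin.prod_univ_succ]⟩

variable (e : ℕ)

/-- The product of `e + 1` generic linear forms. -/
noncomputable def genericLinearFormProd :
    Polynomial (MvPolynomial ((Fin (e + 1) ⊕ Fin (e + 1)) ⊕ Fin e) ℤ) :=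
  linearFormProd (fun i ↦ MvPolynomial.X (.inl (.inl i))) fun i ↦ MvPolynomial.X (.inl (.inr i))

/-- The generic polynomial `T * Q - S`. -/
noncomputable def genericMulXSub :
    Polynomial (MvPolynomial (Fin (e + 1) ⊕ Fin (e + 1)) ℤ) :=
  mulXSub (fun i ↦ MvPolynomial.X (.inl i)) fun i ↦ MvPolynomial.X (.inr i)

/-- The embedding that factors the generic polynomial `T * Q - S` into generic linear forms. -/
noncomputable def factorHom :
    MvPolynomial (Fin (e + 1) ⊕ Fin (e + 1)) ℤ →ₐ[ℤ]
      MvPolynomial ((Fin (e + 1) ⊕ Fin (e + 1)) ⊕ Fin e) ℤ :=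
  MvPolynomial.aeval (Sum.elim
    (Fin.lastCases (∏ i, MvPolynomial.X (.inl (.inr i))) fun i ↦ MvPolynomial.X (.inr i))
    (Fin.cases (-(genericLinearFormProd e).coeff 0) fun i ↦
      MvPolynomial.X (.inr i) - (genericLinearFormProd e).coeff (i + 1)))

theorem factorHom_inl_castSucc (i : Fin e) :
    factorHom e (MvPolynomial.X (.inl i.castSucc)) = MvPolynomial.X (.inr i) := by
  simp [factorHom]

theorem factorHom_inl_last :
    factorHom e (MvPolynomial.X (.inl (Fin.last e))) =
      ∏ i, MvPolynomial.X (.inl (.inr i)) := by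
  simp [factorHom]

theorem factorHom_inr_zero :
    factorHom e (MvPolynomial.X (.inr 0)) = -(genericLinearFormProd e).coeff 0 := by
  simp [factorHom]

theorem factorHom_inr_succ (i : Fin e) :
    factorHom e (MvPolynomial.X (.inr i.succ)) =
      MvPolynomial.X (.inr i) - (genericLinearFormProd e).coeff (i + 1) := by
  simp [factorHom]

theorem map_factorHom_genericMulXSub :
    (genericMulXSub e).map (factorHom e).toRingHom = genericLinearFormProd e := by
  rw [genericMulXSub, map_mulXSub]
  refine mulXSub_eq (natDegree_linearFormProd_le _ _) ?_ (fun i ↦ ?_) ?_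
  · simp [factorHom_inr_zero]
  · simp [factorHom_inl_castSucc, factorHom_inr_succ]
  · simp [factorHom_inl_last, genericLinearFormProd, coeff_linearFormProd]

theorem map_permPoints_genericLinearFormProd (σ : Equiv.Perm (Fin (e + 1))) :
    (genericLinearFormProd e).map (permPoints (Fin e) σ).toRingHom = genericLinearFormProd e := by
  rw [genericLinearFormProd, map_linearFormProd]
  conv_rhs => rw [← linearFormProd_comp_perm _ _ σ]
  congr 1 <;> ext i : 1 <;> simp [permPoints]

theorem permPoints_factorHom (σ : Equiv.Perm (Fin (e + 1)))
    (P : MvPolynomial (Fin (e + 1) ⊕ Fin (e + 1)) ℤ) :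
    permPoints (Fin e) σ (factorHom e P) = factorHom e P := by
  have hc (k : ℕ) : permPoints (Fin e) σ ((genericLinearFormProd e).coeff k) =
      (genericLinearFormProd e).coeff k := by
    conv_rhs => rw [← map_permPoints_genericLinearFormProd e σ]
    exact (Polynomial.coeff_map _ _).symm
  have hw (i : Fin e) : permPoints (Fin e) σ (MvPolynomial.X (.inr i)) =
      MvPolynomial.X (.inr i) := by
    simp [permPoints]
  suffices h : (permPoints (Fin e) σ).comp (factorHom e) = factorHom e from
    DFunLike.congr_fun h P
  ext1 i
  rw [AlgHom.comp_apply]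
  obtain i | i := i
  · induction i using Fin.lastCases with
    | last =>
      rw [factorHom_inl_last, ← coeff_linearFormProd (fun i ↦ MvPolynomial.X (.inl (.inl i)))]
      exact hc (e + 1)
    | cast i => rw [factorHom_inl_castSucc, hw]
  · induction i using Fin.cases with
    | zero => rw [factorHom_inr_zero, map_neg, hc]
    | succ i => rw [factorHom_inr_succ, map_sub, hw, hc]

theorem factorHom_injective : Function.Injective (factorHom e) := by
  set R := MvPolynomial (Fin (e + 1) ⊕ Fin (e + 1)) ℤ
  let K := AlgebraicClosure (FractionRing R)
  let i : R →+* K := (algebraMap (FractionRing R) K).comp (algebraMap R (FractionRing R))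
  have hi : Function.Injective i :=
    (algebraMap (FractionRing R) K).injective.comp (IsFractionRing.injective R (FractionRing R))
  have hdeg : ((genericMulXSub e).map i).natDegree = e + 1 := by
    rw [genericMulXSub, map_mulXSub]
    refine Polynomial.natDegree_eq_of_le_of_coeff_ne_zero (natDegree_mulXSub_le _ _) ?_
    rw [coeff_last_mulXSub, Function.comp_apply, map_ne_zero_iff i hi]
    exact MvPolynomial.X_ne_zero _
  obtain ⟨x, y, hxy⟩ := exists_eq_linearFormProd e _ hdeg
  let ψ : MvPolynomial ((Fin (e + 1) ⊕ Fin (e + 1)) ⊕ Fin e) ℤ →ₐ[ℤ] K :=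
    MvPolynomial.aeval
      (Sum.elim (Sum.elim x y) fun j ↦ i (MvPolynomial.X (.inl j.castSucc)))
  have hψ : (genericLinearFormProd e).map ψ.toRingHom = (genericMulXSub e).map i := by
    rw [hxy, genericLinearFormProd, map_linearFormProd]
    congr 1 <;> ext j : 1 <;> simp [ψ]
  have hc (k : ℕ) : ψ ((genericLinearFormProd e).coeff k) = i ((genericMulXSub e).coeff k) := by
    have := congrArg (fun P ↦ Polynomial.coeff P k) hψ
    simpa using this
  have hw (j : Fin e) : ψ (MvPolynomial.X (.inr j)) = i (MvPolynomial.X (.inl j.castSucc)) := by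
    simp [ψ]
  have hcomp : ψ.toRingHom.comp (factorHom e).toRingHom = i := by
    refine MvPolynomial.ringHom_ext (fun r ↦ by simp) fun j ↦ ?_
    change ψ (factorHom e _) = _
    obtain j | j := j
    · induction j using Fin.lastCases with
      | last =>
        rw [factorHom_inl_last, ← coeff_linearFormProd (fun i ↦ MvPolynomial.X (.inl (.inl i)))]
        exact (hc (e + 1)).trans (congrArg i (coeff_last_mulXSub _ _))
      | cast j => rw [factorHom_inl_castSucc, hw]
    · induction j using Fin.cases with
      | zero =>
        rw [factorHom_inr_zero, map_neg, hc, genericMulXSub, coeff_zero_mulXSub, map_neg]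
        exact neg_neg _
      | succ j =>
        rw [factorHom_inr_succ, map_sub, hw, hc, genericMulXSub, coeff_succ_mulXSub]; simp
  refine Function.Injective.of_comp (f := ψ) ?_
  rwa [← hcomp] at hi

theorem natDegree_genericMulXSub : (genericMulXSub e).natDegree = e + 1 := by
  refine Polynomial.natDegree_eq_of_le_of_coeff_ne_zero (natDegree_mulXSub_le _ _) ?_
  rw [genericMulXSub, coeff_last_mulXSub]
  exact MvPolynomial.X_ne_zero _

theorem leadingCoeff_genericMulXSub :
    (genericMulXSub e).leadingCoeff = MvPolynomial.X (.inl (Fin.last e)) := by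
  rw [Polynomial.leadingCoeff, natDegree_genericMulXSub, genericMulXSub, coeff_last_mulXSub]

theorem exists_resultant_genericMulXSub_derivative :
    ∃ D, Polynomial.resultant (genericMulXSub e) (Polynomial.derivative (genericMulXSub e))
      (e + 1) e = MvPolynomial.X (.inl (Fin.last e)) * D := by
  have h := Polynomial.resultant_deriv (f := genericMulXSub e)
    (Polynomial.natDegree_pos_iff_degree_pos.mp (by simp [natDegree_genericMulXSub]))
  rw [natDegree_genericMulXSub, leadingCoeff_genericMulXSub, add_tsub_cancel_right] at h
  exact ⟨_, h.trans (by rw [mul_assoc, mul_left_comm])⟩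

theorem exists_factorHom_eq_bracketVandermonde_sq (he : 1 ≤ e)
    {D : MvPolynomial (Fin (e + 1) ⊕ Fin (e + 1)) ℤ}
    (hD : Polynomial.resultant (genericMulXSub e) (Polynomial.derivative (genericMulXSub e))
      (e + 1) e = MvPolynomial.X (.inl (Fin.last e)) * D) :
    ∃ ε, IsUnit ε ∧ factorHom e D = ε * bracketVandermonde (e + 1) (Fin e) ^ 2 := by
  refine ⟨∏ j : Fin (e + 1), ∏ _i ∈ Iio j, (-1), ?_, ?_⟩
  · simp [isUnit_neg_one.pow]
  have hne : ∏ i : Fin (e + 1), (MvPolynomial.X (.inl (.inr i)) :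
      MvPolynomial ((Fin (e + 1) ⊕ Fin (e + 1)) ⊕ Fin e) ℤ) ≠ 0 :=
    prod_ne_zero_iff.mpr fun _ _ ↦ MvPolynomial.X_ne_zero _
  have h := congrArg (factorHom e).toRingHom hD
  rw [← Polynomial.resultant_map_map, ← Polynomial.derivative_map, map_factorHom_genericMulXSub,
    genericLinearFormProd,
    resultant_linearFormProd_derivative e he _ _ fun _ ↦ MvPolynomial.X_ne_zero _] at h
  rw [← prod_prod_erase_bracket]
  refine mul_left_cancel₀ hne (Eq.trans ?_ h.symm)
  rw [← factorHom_inl_last]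
  exact (map_mul _ _ _).symm

theorem isUnit_of_isUnit_factorHom {P : MvPolynomial (Fin (e + 1) ⊕ Fin (e + 1)) ℤ}
    (hP : IsUnit (factorHom e P)) : IsUnit P := by
  obtain ⟨r, hr, h⟩ := MvPolynomial.isUnit_iff_eq_C_of_isReduced.mp hP
  rw [← MvPolynomial.algebraMap_eq, ← MvPolynomial.algHom_C (factorHom e)] at h
  rw [factorHom_injective e h]
  exact hr.map MvPolynomial.C

theorem irreducible_of_resultant_genericMulXSub_derivative_eq (he : 1 ≤ e)
    {D : MvPolynomial (Fin (e + 1) ⊕ Fin (e + 1)) ℤ}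
    (hD : Polynomial.resultant (genericMulXSub e) (Polynomial.derivative (genericMulXSub e))
      (e + 1) e = MvPolynomial.X (.inl (Fin.last e)) * D) : Irreducible D := by
  obtain ⟨ε, hε, h⟩ := exists_factorHom_eq_bracketVandermonde_sq e he hD
  refine ⟨fun hu ↦ ?_, fun P Q hPQ ↦ ?_⟩
  · have hV : IsUnit (bracketVandermonde (e + 1) (Fin e)) :=
      (isUnit_pow_iff two_ne_zero).mp (isUnit_of_mul_isUnit_right (h ▸ hu.map (factorHom e)))
    have h01 : (0 : Fin (e + 1)) < Fin.last e := Fin.lt_def.mpr he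
    refine (prime_bracket (κ := Fin e) h01.ne).not_isUnit (isUnit_of_dvd_unit ?_ hV)
    exact (dvd_prod_of_mem (fun i ↦ bracket (Fin e) i (Fin.last e)) (mem_Iio.mpr h01)).trans
      (dvd_prod_of_mem (fun j ↦ ∏ i ∈ Iio j, bracket (Fin e) i j) (mem_univ _))
  · rw [hPQ, map_mul] at h
    exact (isUnit_or_isUnit_of_mul_eq_bracketVandermonde_sq (by omega)
      (fun σ ↦ permPoints_factorHom e σ P) (fun σ ↦ permPoints_factorHom e σ Q) hε h).imp
      (isUnit_of_isUnit_factorHom e) (isUnit_of_isUnit_factorHom e)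

end Generic

/-- For generic univariate polynomials `Q`, `S` of degree `e ≥ 1` and `G = T·Q − S`
(of degree `e+1` with leading coefficient `u_e`), the resultant `Res(G, G')` factors
as `u_e · D` with `D` — the discriminant of `G` up to sign — irreducible in the
universal coefficient ring `ℤ[u₀,…,u_e, v₀,…,v_e]`. -/
theorem discriminant_XQ_sub_S_generic_irreducible (e : ℕ) (he : 1 ≤ e)
    (Q S : Polynomial (MvPolynomial (Fin (e + 1) ⊕ Fin (e + 1)) ℤ))
    (hQ : Q = ∑ i : Fin (e + 1),
      Polynomial.C (MvPolynomial.X (Sum.inl i)) * Polynomial.X ^ (i : ℕ))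
    (hS : S = ∑ i : Fin (e + 1),
      Polynomial.C (MvPolynomial.X (Sum.inr i)) * Polynomial.X ^ (i : ℕ))
    (G : Polynomial (MvPolynomial (Fin (e + 1) ⊕ Fin (e + 1)) ℤ))
    (hG : G = Polynomial.X * Q - S) :
    ∃ D : MvPolynomial (Fin (e + 1) ⊕ Fin (e + 1)) ℤ,
      res (e + 1) e G (Polynomial.derivative G) =
        MvPolynomial.X (Sum.inl (Fin.last e)) * D ∧
      Irreducible D := by
  have hG' : G = genericMulXSub e := by rw [hG, hQ, hS]; rfl
  subst hG'
  have hdeg := (natDegree_genericMulXSub e).le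
  have hder : (Polynomial.derivative (genericMulXSub e)).natDegree ≤ e := by
    have := Polynomial.natDegree_derivative_le (genericMulXSub e)
    omega
  obtain ⟨D, hD⟩ := exists_resultant_genericMulXSub_derivative e
  have hirr := irreducible_of_resultant_genericMulXSub_derivative_eq e he hD
  have hu : IsUnit ((-1) ^ (e * (e + 1)) :
      MvPolynomial (Fin (e + 1) ⊕ Fin (e + 1)) ℤ) := isUnit_neg_one.pow _
  refine ⟨(-1) ^ (e * (e + 1)) * D, ?_, (irreducible_isUnit_mul hu).mpr hirr⟩
  rw [res_eq_resultant _ _ _ _ hdeg hder, Polynomial.resultant_comm, hD, mul_left_comm]
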